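/- Let S be a set of n ≥ 225 points in ℝ³, no three collinear, such that no plane contains n − 1 or more points of S. Let m be the number of planes determined by S and t the number of lines determined by S. Then m ≥ t. -/

import Mathlib

open Set

noncomputable section

/-- Three-dimensional euclidean space. -/
abbrev Pt3 := EuclideanSpace ℝ (Fin 3)

/-- A plane in space: the affine span of three affinely independent points. -/
def IsPlane (P : Set Pt3) : Prop :=
  ∃ a b c : Pt3, AffineIndependent ℝ ![a, b, c] ∧
    P = (affineSpan ℝ ({a, b, c} : Set Pt3) : Set Pt3)

/-- `planeCount S k` is the number of planes containing exactly `k` points of `S`. -/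
def planeCount (S : Set Pt3) (k : ℕ) : ℕ :=
  {P : Set Pt3 | IsPlane P ∧ (S ∩ P).ncard = k}.ncard

/-- The planes determined by `S`: planes containing at least three points of `S`. -/
def detPlanes (S : Set Pt3) : Set (Set Pt3) :=
  {P : Set Pt3 | IsPlane P ∧ 3 ≤ (S ∩ P).ncard}

/-- No three points of `S` are collinear. -/
def NoThreeCollinear (S : Set Pt3) : Prop :=
  ∀ T ⊆ S, T.ncard = 3 → ¬ Collinear ℝ T
/-- A line in space: the affine span of two distinct points. -/
def IsLine3 (L : Set Pt3) : Prop :=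
  ∃ p q : Pt3, p ≠ q ∧ L = (affineSpan ℝ ({p, q} : Set Pt3) : Set Pt3)

/-- The lines determined by `S`: lines containing at least two points of `S`. -/
def detLines3 (S : Set Pt3) : Set (Set Pt3) :=
  {L : Set Pt3 | IsLine3 L ∧ 2 ≤ (S ∩ L).ncard}


section Melchior

open Finset
open scoped Classical

variable {ι κ : Type*}

/-- The points `a` of the line `M` such that the line through `a` whose slope immediately precedes
that of `M` carries a point to the left of `a`. -/
def leftTurns (x : ι → ℝ) (lines : Finset κ) (pts : κ → Finset ι) (sl : κ → ℝ) (M : κ) :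
    Finset ι :=
  (pts M).filter fun a => ∃ L ∈ lines, a ∈ pts L ∧ sl L < sl M ∧
    (∀ N ∈ lines, a ∈ pts N → sl N < sl M → sl N ≤ sl L) ∧ ∃ q ∈ pts L, x q < x a

lemma sum_card_le_sum_card_leftTurns (T : Finset ι) (x : ι → ℝ) (hx : InjOn x T)
    (lines : Finset κ) (pts : κ → Finset ι) (sl : κ → ℝ)
    (hsub : ∀ L ∈ lines, pts L ⊆ T)
    (hsl : ∀ L ∈ lines, ∀ M ∈ lines, ∀ a, a ∈ pts L → a ∈ pts M → sl L = sl M → L = M) :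
    ∑ L ∈ lines, #(pts L) ≤ ∑ L ∈ lines, #(leftTurns x lines pts sl L) + #lines + #T := by
  let r : κ → ι → Prop := fun L a => a ∈ pts L ∧ ∃ q ∈ pts L, x q < x a
  let r' : κ → ι → Prop := fun L a => a ∈ leftTurns x lines pts sl L
  have h1 : ∀ L ∈ lines, #(pts L) ≤ #(T.filter (r L)) + 1 := by
    intro L hL
    have hle : #((pts L).filter fun a => ¬ ∃ q ∈ pts L, x q < x a) ≤ 1 := by
      rw [Finset.card_le_one]
      intro a ha b hb
      simp only [Finset.mem_filter, not_exists, not_and, not_lt] at ha hb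
      exact hx (hsub L hL ha.1) (hsub L hL hb.1) (le_antisymm (ha.2 b hb.1) (hb.2 a ha.1))
    have heq : (pts L).filter (fun a => ∃ q ∈ pts L, x q < x a) ⊆ T.filter (r L) := by
      intro a ha
      rw [Finset.mem_filter] at ha ⊢
      exact ⟨hsub L hL ha.1, ha.1, ha.2⟩
    have := Finset.card_filter_add_card_filter_not (s := pts L)
      (fun a => ∃ q ∈ pts L, x q < x a)
    have := Finset.card_le_card heq
    omega
  have h2 : ∀ a ∈ T, #(lines.filter (r · a)) ≤ #(lines.filter (r' · a)) + 1 := by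
    intro a _
    have htop : #((lines.filter (r · a)).filter
        fun L => ¬ ∃ M ∈ lines, a ∈ pts M ∧ sl L < sl M) ≤ 1 := by
      rw [Finset.card_le_one]
      intro L hL M hM
      simp only [Finset.mem_filter, not_exists, not_and, not_lt] at hL hM
      exact hsl L hL.1.1 M hM.1.1 a hL.1.2.1 hM.1.2.1
        (le_antisymm (hM.2 L hL.1.1 hL.1.2.1) (hL.2 M hM.1.1 hM.1.2.1))
    have hnext : #((lines.filter (r · a)).filter
        fun L => ∃ M ∈ lines, a ∈ pts M ∧ sl L < sl M) ≤ #(lines.filter (r' · a)) := by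
      apply Finset.card_le_card_of_forall_subsingleton
        (fun L M => sl L < sl M ∧ ∀ N ∈ lines, a ∈ pts N → sl N < sl M → sl N ≤ sl L)
      · intro L hL
        simp only [Finset.mem_filter] at hL
        obtain ⟨⟨hLl, haL, q, hq, hqa⟩, M₀, hM₀, haM₀, hlt⟩ := hL
        obtain ⟨M, hM, hmin⟩ := Finset.exists_min_image
          (lines.filter fun M => a ∈ pts M ∧ sl L < sl M) sl
          ⟨M₀, Finset.mem_filter.2 ⟨hM₀, haM₀, hlt⟩⟩
        rw [Finset.mem_filter] at hM
        have hpred : ∀ N ∈ lines, a ∈ pts N → sl N < sl M → sl N ≤ sl L := by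
          intro N hN haN hNM
          by_contra! h
          exact absurd (hmin N (Finset.mem_filter.2 ⟨hN, haN, h⟩)) (not_le.2 hNM)
        refine ⟨M, Finset.mem_filter.2 ⟨hM.1, Finset.mem_filter.2 ⟨hM.2.1, ?_⟩⟩, hM.2.2, hpred⟩
        exact ⟨L, hLl, haL, hM.2.2, hpred, q, hq, hqa⟩
      · intro M _ L hL L' hL'
        simp only [Set.mem_ofPred_eq, Finset.mem_filter] at hL hL'
        exact hsl L hL.1.1.1 L' hL'.1.1.1 a hL.1.1.2.1 hL'.1.1.2.1
          (le_antisymm (hL'.2.2 L hL.1.1.1 hL.1.1.2.1 hL.2.1)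
            (hL.2.2 L' hL'.1.1.1 hL'.1.1.2.1 hL'.2.1))
    have := Finset.card_filter_add_card_filter_not (s := lines.filter (r · a))
      (fun L => ∃ M ∈ lines, a ∈ pts M ∧ sl L < sl M)
    omega
  have h3 : ∑ L ∈ lines, #(T.filter (r L)) = ∑ a ∈ T, #(lines.filter (r · a)) :=
    Finset.sum_card_bipartiteAbove_eq_sum_card_bipartiteBelow r
  have h4 : ∑ L ∈ lines, #(T.filter (r' L)) = ∑ a ∈ T, #(lines.filter (r' · a)) :=
    Finset.sum_card_bipartiteAbove_eq_sum_card_bipartiteBelow r'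
  have h5 : ∑ L ∈ lines, #(T.filter (r' L)) ≤ ∑ L ∈ lines, #(leftTurns x lines pts sl L) :=
    Finset.sum_le_sum fun L _ => Finset.card_le_card fun a ha => (Finset.mem_filter.1 ha).2
  have h6 := Finset.sum_le_sum h1
  have h7 := Finset.sum_le_sum h2
  rw [Finset.sum_add_distrib, Finset.sum_const, smul_eq_mul, mul_one] at h6 h7
  omega

/-- A weak form of Melchior's inequality. -/
lemma sum_card_le_three_mul_card_lines (T : Finset ι) (x y : ι → ℝ) (hx : InjOn x T)
    (lines : Finset κ) (pts : κ → Finset ι) (sl : κ → ℝ)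
    (hsub : ∀ L ∈ lines, pts L ⊆ T)
    (hjoin : ∀ a ∈ T, ∀ b ∈ T, a ≠ b → ∃ L ∈ lines, a ∈ pts L ∧ b ∈ pts L)
    (hline : ∀ L ∈ lines, ∀ a ∈ pts L, ∀ b ∈ pts L, y b - y a = sl L * (x b - x a))
    (hsl : ∀ L ∈ lines, ∀ M ∈ lines, ∀ a, a ∈ pts L → a ∈ pts M → sl L = sl M → L = M) :
    ∑ L ∈ lines, #(pts L) ≤ 3 * #lines + 2 * #T := by
  have hA := sum_card_le_sum_card_leftTurns T x hx lines pts sl hsub hsl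
  have hB := sum_card_le_sum_card_leftTurns T (fun a => -x a)
    (fun a ha b hb h => hx ha hb (neg_injective h)) lines pts sl hsub hsl
  have hAB : ∀ M ∈ lines, #(leftTurns x lines pts sl M) +
      #(leftTurns (fun a => -x a) lines pts sl M) ≤ #(pts M) + 1 := by
    intro M hM
    have key : ∀ a ∈ leftTurns x lines pts sl M,
        ∀ b ∈ leftTurns (fun a => -x a) lines pts sl M, x b ≤ x a := by
      intro a ha b hb
      obtain ⟨haM, L, hL, haL, hLM, hLmax, q, hq, hqa⟩ := Finset.mem_filter.1 ha
      obtain ⟨hbM, L', hL', hbL', hLM', hLmax', q', hq', hqb'⟩ := Finset.mem_filter.1 hb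
      by_contra! hab
      have hbq' : x b < x q' := by simpa using hqb'
      obtain ⟨N, hN, hqN, hbN⟩ := hjoin q (hsub L hL hq) b (hsub M hM hbM)
        (by rintro rfl; linarith)
      obtain ⟨N', hN', haN', hqN'⟩ := hjoin a (hsub M hM haM) q' (hsub L' hL' hq')
        (by rintro rfl; linarith)
      have e1 := hline M hM a haM b hbM
      have e2 := hline L hL q hq a haL
      have e3 := hline N hN q hqN b hbN
      have e4 := hline L' hL' b hbL' q' hq'
      have e5 := hline N' hN' a haN' q' hqN'
      have f1 : sl N < sl M := by
        by_contra! h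
        nlinarith [mul_le_mul_of_nonneg_right h (by linarith : 0 ≤ x b - x q),
          mul_lt_mul_of_pos_right hLM (by linarith : 0 < x a - x q)]
      have f2 : sl L < sl N := by
        by_contra! h
        nlinarith [mul_le_mul_of_nonneg_right h (by linarith : 0 ≤ x b - x q),
          mul_lt_mul_of_pos_right hLM (by linarith : 0 < x b - x a)]
      have f3 : sl N' < sl M := by
        by_contra! h
        nlinarith [mul_le_mul_of_nonneg_right h (by linarith : 0 ≤ x q' - x a),
          mul_lt_mul_of_pos_right hLM' (by linarith : 0 < x q' - x b)]
      have f4 : sl L' < sl N' := by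
        by_contra! h
        nlinarith [mul_le_mul_of_nonneg_right h (by linarith : 0 ≤ x q' - x a),
          mul_lt_mul_of_pos_right hLM' (by linarith : 0 < x b - x a)]
      linarith [hLmax' N hN hbN f1, hLmax N' hN' haN' f3]
    rw [← Finset.card_union_add_card_inter]
    refine add_le_add (Finset.card_le_card (Finset.union_subset (Finset.filter_subset _ _)
      (Finset.filter_subset _ _))) (Finset.card_le_one.2 fun a ha b hb => ?_)
    rw [Finset.mem_inter] at ha hb
    exact hx (hsub M hM (Finset.mem_filter.1 ha.1).1) (hsub M hM (Finset.mem_filter.1 hb.1).1)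
      (le_antisymm (key b hb.1 a ha.2) (key a ha.1 b hb.2))
  have hsum := Finset.sum_le_sum hAB
  rw [Finset.sum_add_distrib, Finset.sum_add_distrib, Finset.sum_const, smul_eq_mul,
    mul_one] at hsum
  omega

end Melchior

section Blocks

open Finset

variable {α : Type*} [DecidableEq α]

/-- Lower bound for the number of blocks which meet a fixed block in two points and contain a
point of a fixed set outside it. -/
lemma card_blocks_ge_of_outside (S : Finset α) (B : Finset (Finset α))
    (hjoin : ∀ a ∈ S, ∀ b ∈ S, ∀ c ∈ S, a ≠ b → a ≠ c → b ≠ c →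
      ∃ F ∈ B, a ∈ F ∧ b ∈ F ∧ c ∈ F)
    (hinter : ∀ F ∈ B, ∀ G ∈ B, F ≠ G → #(F ∩ G) ≤ 2)
    (P : Finset α) (hP : P ∈ B) (hPS : P ⊆ S) (R : Finset α) (hR : R ⊆ S \ P) :
    2 * (#R : ℤ) * (#P * (#P - 1)) - #P * (#R * (#R - 1)) ≤ 4 * #B := by
  let Q : α → Finset (Finset α) := fun a => B.filter fun F => a ∈ F ∧ #(F ∩ P) = 2
  have hne : ∀ a ∈ S \ P, ∀ F, a ∈ F → F ≠ P := by
    rintro a ha F haF rfl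
    exact (Finset.mem_sdiff.1 ha).2 haF
  have hQ : ∀ a ∈ S \ P, (#P : ℤ) * (#P - 1) ≤ 2 * #(Q a) := by
    intro a ha
    have h : #(P.powersetCard 2) ≤ #(Q a) := by
      apply Finset.card_le_card_of_surjOn (fun F => F ∩ P)
      intro e he
      obtain ⟨heP, he2⟩ := Finset.mem_powersetCard.1 he
      obtain ⟨u, v, huv, rfl⟩ := Finset.card_eq_two.1 he2
      have hu : u ∈ P := heP (by simp)
      have hv : v ∈ P := heP (by simp)
      obtain ⟨haS, haP⟩ := Finset.mem_sdiff.1 ha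
      obtain ⟨F, hF, haF, huF, hvF⟩ := hjoin a haS u (hPS hu) v (hPS hv)
        (by rintro rfl; exact haP hu) (by rintro rfl; exact haP hv) huv
      have hsub : ({u, v} : Finset α) ⊆ F ∩ P := by
        intro z hz
        rw [Finset.mem_insert, Finset.mem_singleton] at hz
        rcases hz with rfl | rfl <;> simp [*]
      have heq := Finset.eq_of_subset_of_card_le hsub
        (by rw [he2]; exact hinter F hF P hP (hne a ha F haF))
      exact ⟨F, Finset.mem_coe.2 (Finset.mem_filter.2 ⟨hF, haF, by rw [← heq, he2]⟩), heq.symm⟩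
    rw [Finset.card_powersetCard] at h
    have h2 : (#P : ℚ) * (#P - 1) / 2 ≤ #(Q a) := by
      rw [← Nat.cast_choose_two]
      exact_mod_cast h
    have h3 : (#P : ℚ) * (#P - 1) ≤ 2 * #(Q a) := by linarith
    exact_mod_cast h3
  have hQQ : ∀ a ∈ S \ P, ∀ b ∈ S \ P, a ≠ b → 2 * #(Q a ∩ Q b) ≤ #P := by
    intro a ha b hb hab
    have hd : ((Q a ∩ Q b : Finset (Finset α)) : Set (Finset α)).PairwiseDisjoint
        (fun F => F ∩ P) := by
      intro F hF G hG hFG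
      rw [Finset.mem_coe, Finset.mem_inter, Finset.mem_filter, Finset.mem_filter] at hF hG
      refine Finset.disjoint_left.2 fun z hzF hzG => ?_
      rw [Finset.mem_inter] at hzF hzG
      have hsub : ({a, b, z} : Finset α) ⊆ F ∩ G := by
        intro w hw
        simp only [Finset.mem_insert, Finset.mem_singleton] at hw
        rcases hw with rfl | rfl | rfl <;> simp [hF, hG, hzF, hzG]
      have h3 : #({a, b, z} : Finset α) = 3 := by
        refine Finset.card_eq_three.2 ⟨a, b, z, hab, ?_, ?_, rfl⟩
        · rintro rfl; exact (Finset.mem_sdiff.1 ha).2 hzF.2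
        · rintro rfl; exact (Finset.mem_sdiff.1 hb).2 hzF.2
      have := Finset.card_le_card hsub
      have := hinter F hF.1.1 G hG.1.1 hFG
      omega
    have hU : (Q a ∩ Q b).biUnion (fun F => F ∩ P) ⊆ P :=
      Finset.biUnion_subset.2 fun F _ => Finset.inter_subset_right
    have := Finset.card_le_card hU
    rw [Finset.card_biUnion hd, Finset.sum_congr rfl (g := fun _ => 2)
      (fun F hF => (Finset.mem_filter.1 (Finset.mem_inter.1 hF).1).2.2)] at this
    simpa [mul_comm] using this
  have main : ∀ R : Finset α, R ⊆ S \ P →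
      2 * (#R : ℤ) * (#P * (#P - 1)) - #P * (#R * (#R - 1)) ≤ 4 * #(R.biUnion Q) := by
    intro R
    induction R using Finset.induction_on with
    | empty => intro _; simp
    | insert a R haR ih =>
      intro hR
      rw [Finset.insert_subset_iff] at hR
      have h1 := ih hR.2
      have h2 := hQ a hR.1
      have h3 : 2 * #(Q a ∩ R.biUnion Q) ≤ #R * #P := by
        rw [Finset.inter_biUnion]
        calc 2 * #(R.biUnion fun b => Q a ∩ Q b) ≤ 2 * ∑ b ∈ R, #(Q a ∩ Q b) :=
              Nat.mul_le_mul_left _ Finset.card_biUnion_le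
          _ = ∑ b ∈ R, 2 * #(Q a ∩ Q b) := Finset.mul_sum _ _ _
          _ ≤ ∑ b ∈ R, #P := Finset.sum_le_sum fun b hb =>
              hQQ a hR.1 b (hR.2 hb) (by rintro rfl; exact haR hb)
          _ = #R * #P := by simp
      have h4 := Finset.card_union_add_card_inter (Q a) (R.biUnion Q)
      rw [Finset.biUnion_insert, Finset.card_insert_of_notMem haR]
      zify at h3 h4
      push_cast
      nlinarith
  have hsub : R.biUnion Q ⊆ B := Finset.biUnion_subset.2 fun a _ => Finset.filter_subset _ _
  have h := main R hR
  have : (#(R.biUnion Q) : ℤ) ≤ #B := by exact_mod_cast Finset.card_le_card hsub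
  linarith

/-- If every block is small, the weak Melchior inequality at each point forces many blocks. -/
lemma card_blocks_ge_of_small (S : Finset α) (B : Finset (Finset α)) (hn : 225 ≤ #S)
    (hBS : ∀ F ∈ B, F ⊆ S) (hB3 : ∀ F ∈ B, 3 ≤ #F)
    (hjoin : ∀ a ∈ S, ∀ b ∈ S, ∀ c ∈ S, a ≠ b → a ≠ c → b ≠ c →
      ∃ F ∈ B, a ∈ F ∧ b ∈ F ∧ c ∈ F)
    (hmel : ∀ p ∈ S, ∑ F ∈ B.filter (p ∈ ·), ((#F : ℝ) - 4) ≤ 2 * (#S - 1))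
    (hsmall : ∀ F ∈ B, 7 * #F + 24 ≤ 2 * #S) :
    (#S : ℝ) * (#S - 1) ≤ 2 * #B := by
  set n : ℝ := (#S : ℝ) with hndef
  have hn' : (225 : ℝ) ≤ n := by rw [hndef]; exact_mod_cast hn
  have htrip : n * (n - 1) * (n - 2) ≤ ∑ F ∈ B, (#F : ℝ) * (#F - 1) * (#F - 2) := by
    have hsub : S.powersetCard 3 ⊆ B.biUnion fun F => F.powersetCard 3 := by
      intro e he
      obtain ⟨heS, he3⟩ := Finset.mem_powersetCard.1 he
      obtain ⟨a, b, c, hab, hac, hbc, rfl⟩ := Finset.card_eq_three.1 he3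
      obtain ⟨F, hF, ha, hb, hc⟩ := hjoin a (heS (by simp)) b (heS (by simp)) c
        (heS (by simp)) hab hac hbc
      refine Finset.mem_biUnion.2 ⟨F, hF, Finset.mem_powersetCard.2 ⟨?_, he3⟩⟩
      intro z hz
      simp only [Finset.mem_insert, Finset.mem_singleton] at hz
      rcases hz with rfl | rfl | rfl <;> assumption
    have h1 := (Finset.card_le_card hsub).trans Finset.card_biUnion_le
    simp only [Finset.card_powersetCard] at h1
    have hch : ∀ k : ℕ, (k : ℝ) * (k - 1) * (k - 2) = 6 * (k.choose 3 : ℕ) := by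
      intro k
      rw [Nat.cast_choose_eq_ascPochhammer_div]
      rcases k with _ | _ | k
      · simp [ascPochhammer_succ_eval]
      · simp [ascPochhammer_succ_eval]
      · simp [ascPochhammer_succ_eval, Nat.factorial]
        ring
    rw [hndef, hch, Finset.sum_congr rfl fun F _ => hch #F, ← Finset.mul_sum]
    have h2 : ((S.card.choose 3 : ℕ) : ℝ) ≤ ∑ F ∈ B, (((#F).choose 3 : ℕ) : ℝ) := by
      exact_mod_cast h1
    linarith
  have hmelsum : ∑ F ∈ B, (#F : ℝ) * (#F - 4) ≤ 2 * n * (n - 1) := by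
    have h1 := Finset.sum_le_sum hmel
    rw [Finset.sum_comm' (s' := fun F => F) (t' := B)] at h1
    · simp only [Finset.sum_const, nsmul_eq_mul] at h1
      linarith
    · intro p F
      rw [Finset.mem_filter]
      exact ⟨fun h => ⟨h.2.2, h.2.1⟩, fun h => ⟨hBS F h.2 h.1, h.2, h.1⟩⟩
  have hpt : ∀ F ∈ B, (#F : ℝ) * (#F - 1) * (#F - 2) ≤
      (2 * n - 10) / 7 * (#F * (#F - 4)) + (6 + 3 * ((2 * n - 10) / 7)) := by
    intro F hF
    have hk : (7 * #F + 24 : ℝ) ≤ 2 * n := by rw [hndef]; exact_mod_cast hsmall F hF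
    have hk3 := hB3 F hF
    set A := (2 * n - 10) / 7 with hA
    have hA1 : (#F : ℝ) + 2 ≤ A := by rw [hA]; linarith
    have hA2 : (12 : ℝ) ≤ A := by rw [hA]; linarith
    generalize #F = k at *
    rcases (by omega : k = 3 ∨ k = 4 ∨ 5 ≤ k) with rfl | rfl | h5
    · norm_num; linarith
    · norm_num; linarith
    · have h5' : (5 : ℝ) ≤ k := by exact_mod_cast h5
      have : ((k : ℝ) - 1) * (k - 2) ≤ A * (k - 4) := by
        rcases le_total (k : ℝ) 10 with h10 | h10
        · nlinarith
        · nlinarith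
      nlinarith
  have hsum := Finset.sum_le_sum hpt
  rw [Finset.sum_add_distrib, ← Finset.mul_sum, Finset.sum_const, nsmul_eq_mul] at hsum
  have h3 : (2 * n - 10) / 7 * ∑ F ∈ B, (#F : ℝ) * (#F - 4) ≤
      (2 * n - 10) / 7 * (2 * n * (n - 1)) :=
    mul_le_mul_of_nonneg_left hmelsum (by linarith)
  have h4 : n * (n - 1) * (3 * n + 6) ≤ #B * (6 * n + 12) := by nlinarith
  have h5 : (n * (n - 1)) * (3 * n + 6) ≤ (2 * #B) * (3 * n + 6) := by linarith
  exact le_of_mul_le_mul_right h5 (by linarith)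

lemma card_blocks_ge (S : Finset α) (B : Finset (Finset α)) (hn : 225 ≤ #S)
    (hBS : ∀ F ∈ B, F ⊆ S) (hB3 : ∀ F ∈ B, 3 ≤ #F) (hcap : ∀ F ∈ B, #F + 2 ≤ #S)
    (hjoin : ∀ a ∈ S, ∀ b ∈ S, ∀ c ∈ S, a ≠ b → a ≠ c → b ≠ c →
      ∃ F ∈ B, a ∈ F ∧ b ∈ F ∧ c ∈ F)
    (hinter : ∀ F ∈ B, ∀ G ∈ B, F ≠ G → #(F ∩ G) ≤ 2)
    (hmel : ∀ p ∈ S, ∑ F ∈ B.filter (p ∈ ·), ((#F : ℝ) - 4) ≤ 2 * (#S - 1)) :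
    (#S).choose 2 ≤ #B := by
  suffices h : (#S : ℝ) * (#S - 1) ≤ 2 * #B by
    have h2 : (((#S).choose 2 : ℕ) : ℝ) ≤ #B := by
      rw [Nat.cast_choose_two]; linarith
    exact_mod_cast h2
  by_cases hsmall : ∀ F ∈ B, 7 * #F + 24 ≤ 2 * #S
  · exact card_blocks_ge_of_small S B hn hBS hB3 hjoin hmel hsmall
  push Not at hsmall
  obtain ⟨P, hP, hbig⟩ := hsmall
  have hout := Finset.card_sdiff_add_card_eq_card (hBS P hP)
  have hPcap := hcap P hP
  suffices h : (#S : ℤ) * (#S - 1) ≤ 2 * #B by exact_mod_cast h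
  by_cases h20 : 20 ≤ #(S \ P)
  · obtain ⟨R, hR, hRc⟩ := Finset.exists_subset_card_eq h20
    have h := card_blocks_ge_of_outside S B hjoin hinter P hP (hBS P hP) R hR
    rw [hRc] at h
    zify at hbig hn
    push_cast at h
    nlinarith
  · obtain ⟨R, hR, hRc⟩ := Finset.exists_subset_card_eq (by omega : 2 ≤ #(S \ P))
    have h := card_blocks_ge_of_outside S B hjoin hinter P hP (hBS P hP) R hR
    rw [hRc] at h
    have h1 : #S ≤ #P + 19 := by omega
    zify at h1 hn
    push_cast at h
    nlinarith

end Blocks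

section Geometry

open scoped Classical

lemma exists_forall_quadratic_ne_zero (W : Set (ℝ × ℝ × ℝ)) (hW : W.Finite)
    (h0 : ∀ w ∈ W, w ≠ 0) : ∃ s : ℝ, ∀ w ∈ W, w.1 + s * w.2.1 + s ^ 2 * w.2.2 ≠ 0 := by
  have hfin : (⋃ w ∈ W, {s : ℝ | w.1 + s * w.2.1 + s ^ 2 * w.2.2 = 0}).Finite := by
    refine hW.biUnion fun w hw => ?_
    let p : Polynomial ℝ := Polynomial.C w.1 + Polynomial.C w.2.1 * Polynomial.X +
      Polynomial.C w.2.2 * Polynomial.X ^ 2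
    have hp : p ≠ 0 := by
      intro hp
      refine h0 w hw (Prod.ext ?_ (Prod.ext ?_ ?_))
      · simpa [p] using congrArg (Polynomial.coeff · 0) hp
      · simpa [p, Polynomial.coeff_X, Polynomial.coeff_C] using
          congrArg (Polynomial.coeff · 1) hp
      · simpa [p, Polynomial.coeff_X, Polynomial.coeff_C] using
          congrArg (Polynomial.coeff · 2) hp
    refine (p.roots.toFinset.finite_toSet).subset fun s hs => ?_
    have hs' : w.1 + s * w.2.1 + s ^ 2 * w.2.2 = 0 := hs
    simp only [Finset.mem_coe, Multiset.mem_toFinset, Polynomial.mem_roots hp,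
      Polynomial.IsRoot.def]
    simp only [p, Polynomial.eval_add, Polynomial.eval_mul, Polynomial.eval_C, Polynomial.eval_X,
      Polynomial.eval_pow]
    linarith
  obtain ⟨s, hs⟩ := hfin.infinite_compl.nonempty
  exact ⟨s, fun w hw h => hs (Set.mem_biUnion hw h)⟩

/-- A linear form on space, generic for a suitable value of the parameter. -/
def firstForm (s : ℝ) (v : Pt3) : ℝ := v 0 + s * v 1 + s ^ 2 * v 2

/-- A second linear form on space, generic for a suitable value of the parameter. -/
def secondForm (t : ℝ) (v : Pt3) : ℝ := v 1 + t * v 2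

lemma NoThreeCollinear.affineIndependent {S : Set Pt3} (h3 : NoThreeCollinear S) {a b c : Pt3}
    (ha : a ∈ S) (hb : b ∈ S) (hc : c ∈ S) (hab : a ≠ b) (hac : a ≠ c) (hbc : b ≠ c) :
    AffineIndependent ℝ ![a, b, c] := by
  rw [affineIndependent_iff_not_collinear_set]
  refine h3 _ ?_ (Set.ncard_eq_three.2 ⟨a, b, c, hab, hac, hbc, rfl⟩)
  rintro z (rfl | rfl | rfl) <;> assumption

lemma exists_generic_forms (S : Set Pt3) (hS : S.Finite) (h3 : NoThreeCollinear S) :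
    ∃ s t : ℝ, (∀ p ∈ S, ∀ a ∈ S, a ≠ p → firstForm s (a - p) ≠ 0) ∧
      ∀ p ∈ S, ∀ a ∈ S, ∀ b ∈ S, a ≠ p → b ≠ p → a ≠ b →
        secondForm t (a - p) / firstForm s (a - p) ≠
          secondForm t (b - p) / firstForm s (b - p) := by
  obtain ⟨s, hs⟩ := exists_forall_quadratic_ne_zero
    ((fun u : Pt3 × Pt3 => ((u.1 - u.2) 0, (u.1 - u.2) 1, (u.1 - u.2) 2)) ''
      ((S ×ˢ S) ∩ {u | u.1 ≠ u.2})) (((hS.prod hS).inter_of_left _).image _) (by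
      rintro _ ⟨⟨a, b⟩, ⟨-, hab⟩, rfl⟩ h
      refine hab (sub_eq_zero.1 ?_)
      simp only [Prod.ext_iff] at h
      ext i
      fin_cases i
      · exact h.1
      · exact h.2.1
      · exact h.2.2)
  have hf : ∀ p ∈ S, ∀ a ∈ S, a ≠ p → firstForm s (a - p) ≠ 0 := fun p hp a ha hap =>
    hs _ ⟨(a, p), ⟨⟨ha, hp⟩, hap⟩, rfl⟩
  let w : Pt3 × Pt3 × Pt3 → Pt3 := fun u =>
    firstForm s (u.2.2 - u.1) • (u.2.1 - u.1) - firstForm s (u.2.1 - u.1) • (u.2.2 - u.1)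
  obtain ⟨t, ht⟩ := exists_forall_quadratic_ne_zero
    ((fun u => (w u 1, w u 2, 0)) '' ((S ×ˢ S ×ˢ S) ∩ {u | u.2.1 ≠ u.1 ∧ u.2.2 ≠ u.1 ∧
      u.2.1 ≠ u.2.2})) (((hS.prod (hS.prod hS)).inter_of_left _).image _) (by
      rintro _ ⟨⟨p, a, b⟩, ⟨⟨hp, ha, hb⟩, hap, hbp, hab⟩, rfl⟩ h
      simp only [Prod.ext_iff] at h
      obtain ⟨h1, h2, -⟩ := h
      have hwf : firstForm s (w (p, a, b)) = 0 := by
        simp only [firstForm, w, PiLp.sub_apply, PiLp.smul_apply, smul_eq_mul]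
        ring
      have hw0 : w (p, a, b) = 0 := by
        rw [firstForm, show w (p, a, b) 1 = 0 from h1, show w (p, a, b) 2 = 0 from h2] at hwf
        ext i
        fin_cases i
        · simpa using hwf
        · exact h1
        · exact h2
      have hind := h3.affineIndependent hp ha hb hap.symm hbp.symm hab
      rw [affineIndependent_iff_not_collinear_set] at hind
      refine hind ((collinear_iff_of_mem (p₀ := p) (by simp)).2 ⟨a - p, ?_⟩)
      rintro q (rfl | rfl | rfl)
      · exact ⟨0, by simp⟩
      · exact ⟨1, by simp⟩
      · refine ⟨firstForm s (q - p) / firstForm s (a - p), ?_⟩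
        have h : firstForm s (q - p) • (a - p) = firstForm s (a - p) • (q - p) :=
          sub_eq_zero.1 hw0
        rw [div_eq_inv_mul, mul_smul, h, smul_smul, inv_mul_cancel₀ (hf p hp a ha hap)]
        simp)
  refine ⟨s, t, hf, fun p hp a ha b hb hap hbp hab heq => ?_⟩
  rw [div_eq_div_iff (hf p hp a ha hap) (hf p hp b hb hbp)] at heq
  refine ht _ ⟨(p, a, b), ⟨⟨hp, ha, hb⟩, hap, hbp, hab⟩, rfl⟩ ?_
  simp only [w, PiLp.sub_apply, PiLp.smul_apply, smul_eq_mul]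
  simp only [secondForm, PiLp.sub_apply] at heq
  linarith

lemma range_triple (x y z : Pt3) : Set.range ![x, y, z] = {x, y, z} := by
  ext q
  simp [or_comm, or_left_comm, eq_comm]

lemma IsPlane.exists_form {P : Set Pt3} (hP : IsPlane P) :
    ∃ ψ : Pt3 →ₗ[ℝ] ℝ, ψ ≠ 0 ∧ ∀ p ∈ P, ∀ q, q ∈ P ↔ ψ (q - p) = 0 := by
  obtain ⟨a, b, c, hind, rfl⟩ := hP
  set A := affineSpan ℝ ({a, b, c} : Set Pt3) with hA
  have hdim : Module.finrank ℝ A.direction = 2 := by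
    have h := hind.finrank_vectorSpan (n := 2) (by simp)
    rw [hA, direction_affineSpan]
    rwa [range_triple] at h
  have htop : A.direction < ⊤ := by
    rw [lt_top_iff_ne_top]
    intro h
    rw [h, finrank_top, finrank_euclideanSpace_fin] at hdim
    omega
  obtain ⟨ψ, hψ, hle⟩ := Submodule.exists_le_ker_of_lt_top _ htop
  have hker := Module.Dual.finrank_ker_add_one_of_ne_zero (f := ψ) hψ
  rw [finrank_euclideanSpace_fin] at hker
  have heq : A.direction = LinearMap.ker ψ :=
    Submodule.eq_of_le_of_finrank_eq hle (by omega)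
  refine ⟨ψ, hψ, fun p hp q => ?_⟩
  rw [← LinearMap.mem_ker, ← heq, ← vsub_eq_sub, AffineSubspace.vsub_right_mem_direction_iff_mem hp]
  rfl

lemma IsPlane.eq_affineSpan {P : Set Pt3} (hP : IsPlane P) {a b c : Pt3}
    (ha : a ∈ P) (hb : b ∈ P) (hc : c ∈ P) (hind : AffineIndependent ℝ ![a, b, c]) :
    P = affineSpan ℝ ({a, b, c} : Set Pt3) := by
  obtain ⟨u, v, w, hind', rfl⟩ := hP
  have hdim := hind'.finrank_vectorSpan (n := 2) (by simp)
  rw [range_triple, ← direction_affineSpan] at hdim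
  have h := hind.affineSpan_eq_of_le_of_card_eq_finrank_add_one
    (sp := affineSpan ℝ ({u, v, w} : Set Pt3)) (by
      rw [range_triple, affineSpan_le]
      rintro z (rfl | rfl | rfl) <;> assumption) (by rw [hdim]; simp)
  rw [range_triple] at h
  rw [h]

lemma mem_plane_iff_slope (S : Finset Pt3) (s t : ℝ) (p : Pt3)
    (hf : ∀ a ∈ S, a ≠ p → firstForm s (a - p) ≠ 0)
    (hg : ∀ a ∈ S, ∀ b ∈ S, a ≠ p → b ≠ p → a ≠ b →
        secondForm t (a - p) / firstForm s (a - p) ≠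
          secondForm t (b - p) / firstForm s (b - p))
    (P : Set Pt3) (hP : IsPlane P) (hpP : p ∈ P) (h2 : 1 < ((S.filter (· ∈ P)).erase p).card) :
    ∃ σ : ℝ, ∀ a ∈ (S.filter (· ∈ P)).erase p, ∀ b ∈ S.erase p,
      b ∈ P ↔ (b - p) 2 / firstForm s (b - p) - (a - p) 2 / firstForm s (a - p) =
        σ * (secondForm t (b - p) / firstForm s (b - p) -
          secondForm t (a - p) / firstForm s (a - p)) := by
  obtain ⟨ψ, hψ, hmem⟩ := hP.exists_form
  obtain ⟨α, β, γ, hαβγ⟩ : ∃ α β γ : ℝ, ∀ v, ψ v =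
      α * firstForm s v + β * secondForm t v + γ * v 2 := by
    let e : Fin 3 → ℝ := fun i => ψ (EuclideanSpace.single i 1)
    have he : ∀ v, ψ v = v 0 * e 0 + v 1 * e 1 + v 2 * e 2 := by
      intro v
      have hv : v = v 0 • EuclideanSpace.single (0 : Fin 3) (1 : ℝ) +
          v 1 • EuclideanSpace.single 1 1 + v 2 • EuclideanSpace.single 2 1 := by
        ext i
        fin_cases i <;> simp
      conv_lhs => rw [hv]
      simp [e]
    refine ⟨e 0, e 1 - s * e 0, e 2 - s ^ 2 * e 0 - t * (e 1 - s * e 0), fun v => ?_⟩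
    rw [he, firstForm, secondForm]
    ring
  have hiff : ∀ b ∈ S, b ≠ p → (b ∈ P ↔ α + β * (secondForm t (b - p) / firstForm s (b - p)) +
      γ * ((b - p) 2 / firstForm s (b - p)) = 0) := by
    intro b hb hbp
    have hb0 := hf b hb hbp
    rw [hmem p hpP, hαβγ]
    have : α + β * (secondForm t (b - p) / firstForm s (b - p)) +
        γ * ((b - p) 2 / firstForm s (b - p)) =
        (α * firstForm s (b - p) + β * secondForm t (b - p) + γ * (b - p) 2) /
          firstForm s (b - p) := by
      field_simp
    rw [this, div_eq_zero_iff, or_iff_left hb0]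
  have hγ : γ ≠ 0 := by
    rintro rfl
    obtain ⟨a, ha, b, hb, hab⟩ := Finset.one_lt_card.1 h2
    simp only [Finset.mem_erase, Finset.mem_filter] at ha hb
    have ha' := (hiff a ha.2.1 ha.1).1 ha.2.2
    have hb' := (hiff b hb.2.1 hb.1).1 hb.2.2
    have hβ : β = 0 := by
      have h : β * (secondForm t (a - p) / firstForm s (a - p) -
          secondForm t (b - p) / firstForm s (b - p)) = 0 := by linarith
      exact (mul_eq_zero.1 h).resolve_right
        (sub_ne_zero.2 (hg a ha.2.1 b hb.2.1 ha.1 hb.1 hab))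
    have hα : α = 0 := by simpa [hβ] using ha'
    exact hψ (LinearMap.ext fun v => by simp [hαβγ, hα, hβ])
  refine ⟨-β / γ, fun a ha b hb => ?_⟩
  simp only [Finset.mem_erase, Finset.mem_filter] at ha hb
  have ha' := (hiff a ha.2.1 ha.1).1 ha.2.2
  rw [hiff b hb.2 hb.1, div_mul_eq_mul_div, eq_div_iff hγ]
  constructor <;> intro h <;> linarith

lemma sum_card_sub_four_le (S : Finset Pt3) (h3 : NoThreeCollinear (S : Set Pt3))
    (B : Finset (Finset Pt3))
    (hB : ∀ F ∈ B, 3 ≤ F.card ∧ ∃ P, IsPlane P ∧ F = S.filter (· ∈ P))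
    (hjoin : ∀ a ∈ S, ∀ b ∈ S, ∀ c ∈ S, a ≠ b → a ≠ c → b ≠ c →
      ∃ F ∈ B, a ∈ F ∧ b ∈ F ∧ c ∈ F) (p : Pt3) (hp : p ∈ S) :
    ∑ F ∈ B.filter (p ∈ ·), ((F.card : ℝ) - 4) ≤ 2 * (S.card - 1) := by
  obtain ⟨s, t, hf, hg⟩ := exists_generic_forms S S.finite_toSet h3
  let x : Pt3 → ℝ := fun q => secondForm t (q - p) / firstForm s (q - p)
  let y : Pt3 → ℝ := fun q => (q - p) 2 / firstForm s (q - p)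
  have hslope : ∀ F ∈ B.filter (p ∈ ·), ∃ σ : ℝ, ∀ a ∈ F.erase p, ∀ b ∈ S.erase p,
      b ∈ F ↔ y b - y a = σ * (x b - x a) := by
    intro F hF
    rw [Finset.mem_filter] at hF
    obtain ⟨hc, P, hP, rfl⟩ := hB F hF.1
    obtain ⟨σ, hσ⟩ := mem_plane_iff_slope S s t p (hf p hp) (hg p hp) P hP
      (Finset.mem_filter.1 hF.2).2 (by rw [Finset.card_erase_of_mem hF.2]; omega)
    refine ⟨σ, fun a ha b hb => ?_⟩
    rw [← hσ a ha b hb, Finset.mem_filter]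
    exact and_iff_right (Finset.mem_of_mem_erase hb)
  choose! sl hsl using hslope
  have hFS : ∀ F ∈ B, F ⊆ S := by
    intro F hF
    obtain ⟨-, P, -, rfl⟩ := hB F hF
    exact Finset.filter_subset _ _
  have hmel := sum_card_le_three_mul_card_lines (S.erase p) x y (by
      intro a ha b hb hab
      rw [Finset.mem_coe, Finset.mem_erase] at ha hb
      by_contra hne
      exact hg p hp a ha.2 b hb.2 ha.1 hb.1 hne hab)
    (B.filter (p ∈ ·)) (fun F => F.erase p) sl
    (fun F hF => Finset.erase_subset_erase _ (hFS F (Finset.mem_filter.1 hF).1))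
    (by
      intro a ha b hb hab
      rw [Finset.mem_erase] at ha hb
      obtain ⟨F, hF, hpF, haF, hbF⟩ := hjoin p hp a ha.2 b hb.2 ha.1.symm hb.1.symm hab
      exact ⟨F, Finset.mem_filter.2 ⟨hF, hpF⟩, Finset.mem_erase.2 ⟨ha.1, haF⟩,
        Finset.mem_erase.2 ⟨hb.1, hbF⟩⟩)
    (by
      intro F hF a ha b hb
      have hb' := Finset.mem_erase.1 hb
      exact (hsl F hF a ha b (Finset.mem_erase.2
        ⟨hb'.1, hFS F (Finset.mem_filter.1 hF).1 hb'.2⟩)).1 hb'.2)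
    (by
      intro F hF G hG a haF haG heq
      ext q
      by_cases hqp : q = p
      · rw [hqp]
        exact iff_of_true (Finset.mem_filter.1 hF).2 (Finset.mem_filter.1 hG).2
      by_cases hqS : q ∈ S
      · have hq := Finset.mem_erase.2 ⟨hqp, hqS⟩
        rw [hsl F hF a haF q hq, hsl G hG a haG q hq, heq]
      · exact iff_of_false (fun h => hqS (hFS F (Finset.mem_filter.1 hF).1 h))
          (fun h => hqS (hFS G (Finset.mem_filter.1 hG).1 h)))
  have hcard : ∀ F ∈ B.filter (p ∈ ·), ((F.card : ℝ) - 4) = ((F.erase p).card : ℝ) - 3 := by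
    intro F hF
    have := Finset.card_erase_add_one (Finset.mem_filter.1 hF).2
    rw [← this]
    push_cast
    ring
  have hS1 : (S.card : ℝ) - 1 = (S.erase p).card := by
    rw [← Finset.card_erase_add_one hp]
    push_cast
    ring
  rw [Finset.sum_congr rfl hcard, Finset.sum_sub_distrib, Finset.sum_const, nsmul_eq_mul, hS1]
  have hmel' : (∑ F ∈ B.filter (p ∈ ·), ((F.erase p).card : ℝ)) ≤
      3 * ((B.filter (p ∈ ·)).card : ℝ) + 2 * ((S.erase p).card : ℝ) := by exact_mod_cast hmel
  linarith

lemma detPlanes_eq_affineSpan {S P : Set Pt3} (h3 : NoThreeCollinear S) (hP : P ∈ detPlanes S) :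
    ∃ a ∈ S, ∃ b ∈ S, ∃ c ∈ S, P = affineSpan ℝ ({a, b, c} : Set Pt3) := by
  obtain ⟨T, hT, hT3⟩ := Set.exists_subset_card_eq hP.2
  obtain ⟨a, b, c, hab, hac, hbc, rfl⟩ := Set.ncard_eq_three.1 hT3
  have ha := hT (by simp : a ∈ ({a, b, c} : Set Pt3))
  have hb := hT (by simp : b ∈ ({a, b, c} : Set Pt3))
  have hc := hT (by simp : c ∈ ({a, b, c} : Set Pt3))
  exact ⟨a, ha.1, b, hb.1, c, hc.1, hP.1.eq_affineSpan ha.2 hb.2 hc.2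
    (h3.affineIndependent ha.1 hb.1 hc.1 hab hac hbc)⟩

lemma finite_detPlanes {S : Set Pt3} (hS : S.Finite) (h3 : NoThreeCollinear S) :
    (detPlanes S).Finite := by
  refine ((hS.prod (hS.prod hS)).image fun u : Pt3 × Pt3 × Pt3 =>
    (affineSpan ℝ ({u.1, u.2.1, u.2.2} : Set Pt3) : Set Pt3)).subset fun P hP => ?_
  obtain ⟨a, ha, b, hb, c, hc, rfl⟩ := detPlanes_eq_affineSpan h3 hP
  exact ⟨(a, b, c), ⟨ha, hb, hc⟩, rfl⟩

lemma ncard_detLines3_le (S : Finset Pt3) :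
    (detLines3 (S : Set Pt3)).ncard ≤ S.card.choose 2 := by
  have hsub : detLines3 (S : Set Pt3) ⊆
      (fun e : Finset Pt3 => (affineSpan ℝ (e : Set Pt3) : Set Pt3)) '' (S.powersetCard 2) := by
    rintro L ⟨⟨p, q, -, rfl⟩, h2⟩
    obtain ⟨T, hT, hT2⟩ := Set.exists_subset_card_eq h2
    obtain ⟨a, b, hab, rfl⟩ := Set.ncard_eq_two.1 hT2
    have ha := hT (by simp : a ∈ ({a, b} : Set Pt3))
    have hb := hT (by simp : b ∈ ({a, b} : Set Pt3))
    refine ⟨{a, b}, Finset.mem_coe.2 (Finset.mem_powersetCard.2 ⟨?_, Finset.card_pair hab⟩), ?_⟩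
    · intro z hz
      rw [Finset.mem_insert, Finset.mem_singleton] at hz
      rcases hz with rfl | rfl
      · exact ha.1
      · exact hb.1
    · have h := affineSpan_pair_eq_of_mem_of_mem_of_ne (k := ℝ) ha.2 hb.2 hab
      simp only [Finset.coe_insert, Finset.coe_singleton]
      rw [h]
  refine (Set.ncard_le_ncard hsub ((Finset.finite_toSet _).image _)).trans
    ((Set.ncard_image_le (Finset.finite_toSet _)).trans ?_)
  rw [Set.ncard_coe_finset, Finset.card_powersetCard]

end Geometry

open scoped Classical in
/-- If no plane contains all but one of the points, the number of determined planes is at least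
the number of pairs of points. -/
lemma choose_two_le_ncard_detPlanes (S : Finset Pt3) (hn : 225 ≤ S.card)
    (h3 : NoThreeCollinear (S : Set Pt3))
    (hcap : ∀ P : Set Pt3, IsPlane P → (S.filter (· ∈ P)).card + 2 ≤ S.card) :
    S.card.choose 2 ≤ (detPlanes (S : Set Pt3)).ncard := by
  have hfin := finite_detPlanes S.finite_toSet h3
  have hcard : ∀ P : Set Pt3, ((S : Set Pt3) ∩ P).ncard = (S.filter (· ∈ P)).card := by
    intro P
    rw [← Set.ncard_coe_finset, Finset.coe_filter]
    rfl
  let B : Finset (Finset Pt3) := hfin.toFinset.image fun P => S.filter (· ∈ P)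
  have hB : ∀ F ∈ B, 3 ≤ F.card ∧ ∃ P, IsPlane P ∧ F = S.filter (· ∈ P) := by
    intro F hF
    obtain ⟨P, hP, rfl⟩ := Finset.mem_image.1 hF
    have hP' := hfin.mem_toFinset.1 hP
    exact ⟨hcard P ▸ hP'.2, P, hP'.1, rfl⟩
  have hjoin : ∀ a ∈ S, ∀ b ∈ S, ∀ c ∈ S, a ≠ b → a ≠ c → b ≠ c →
      ∃ F ∈ B, a ∈ F ∧ b ∈ F ∧ c ∈ F := by
    intro a ha b hb c hc hab hac hbc
    let P : Set Pt3 := affineSpan ℝ ({a, b, c} : Set Pt3)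
    have hsub : ({a, b, c} : Set Pt3) ⊆ P := subset_affineSpan ℝ _
    have hF : ∀ z ∈ ({a, b, c} : Finset Pt3), z ∈ S.filter (· ∈ P) := by
      intro z hz
      simp only [Finset.mem_insert, Finset.mem_singleton] at hz
      rw [Finset.mem_filter]
      rcases hz with rfl | rfl | rfl
      · exact ⟨ha, hsub (by simp)⟩
      · exact ⟨hb, hsub (by simp)⟩
      · exact ⟨hc, hsub (by simp)⟩
    refine ⟨S.filter (· ∈ P), Finset.mem_image.2 ⟨P, hfin.mem_toFinset.2
      ⟨⟨a, b, c, h3.affineIndependent ha hb hc hab hac hbc, rfl⟩, ?_⟩, rfl⟩,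
      hF a (by simp), hF b (by simp), hF c (by simp)⟩
    rw [hcard, ← Finset.card_eq_three.2 ⟨a, b, c, hab, hac, hbc, rfl⟩]
    exact Finset.card_le_card hF
  have hinter : ∀ F ∈ B, ∀ G ∈ B, F ≠ G → (F ∩ G).card ≤ 2 := by
    intro F hF G hG hFG
    obtain ⟨-, P, hP, rfl⟩ := hB F hF
    obtain ⟨-, Q, hQ, rfl⟩ := hB G hG
    by_contra! h
    obtain ⟨a, b, c, ha, hb, hc, hab, hac, hbc⟩ := Finset.two_lt_card_iff.1 h
    simp only [Finset.mem_inter, Finset.mem_filter] at ha hb hc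
    have hind := h3.affineIndependent ha.1.1 hb.1.1 hc.1.1 hab hac hbc
    apply hFG
    rw [hP.eq_affineSpan ha.1.2 hb.1.2 hc.1.2 hind, hQ.eq_affineSpan ha.2.2 hb.2.2 hc.2.2 hind]
  have hmain := card_blocks_ge S B hn
    (fun F hF => by obtain ⟨-, P, -, rfl⟩ := hB F hF; exact Finset.filter_subset _ _)
    (fun F hF => (hB F hF).1)
    (fun F hF => by obtain ⟨-, P, hP, rfl⟩ := hB F hF; exact hcap P hP)
    hjoin hinter (sum_card_sub_four_le S h3 B hB hjoin)
  rw [Set.ncard_eq_toFinset_card _ hfin]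
  exact hmain.trans Finset.card_image_le

theorem stmt16 (S : Set Pt3) (hS : S.Finite) (n : ℕ) (hn : S.ncard = n)
    (hn225 : 225 ≤ n) (h3 : NoThreeCollinear S)
    (hcap : ∀ P : Set Pt3, IsPlane P → ((S ∩ P).ncard : ℤ) < (n : ℤ) - 1) :
    (detPlanes S).ncard ≥ (detLines3 S).ncard := by
  classical
  lift S to Finset Pt3 using hS
  rw [Set.ncard_coe_finset] at hn
  subst hn
  refine (ncard_detLines3_le S).trans (choose_two_le_ncard_detPlanes S hn225 h3 fun P hP => ?_)
  have h := hcap P hP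
  rw [show (S : Set Pt3) ∩ P = (S.filter (· ∈ P) : Finset Pt3) by rw [Finset.coe_filter]; rfl,
    Set.ncard_coe_finset] at h
  convert (by omega : (S.filter (· ∈ P)).card + 2 ≤ S.card) using 3
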